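/- Let G be a finite group acting faithfully on a set Ω. Then G is an IBIS group on Ω if and only if there exists a matroid M on ground set Ω whose bases are exactly the subsets of Ω of the form {ω₁,…,ω_k} for some irredundant base (ω₁,…,ω_k) of G. -/

import Mathlib

/-- The pointwise stabiliser of a tuple (list) of points of `Ω` in `G`. -/
def listStabilizer (G : Type*) {Ω : Type*} [Group G] [MulAction G Ω] (l : List Ω) : Subgroup G :=
  ⨅ ω ∈ l, MulAction.stabilizer G ω

/-- A tuple is a base for `G` if its pointwise stabiliser is trivial. -/
def IsBaseTuple (G : Type*) {Ω : Type*} [Group G] [MulAction G Ω] (l : List Ω) : Prop :=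
  listStabilizer G l = ⊥

/-- A tuple is irredundant if, for each `i`, the pointwise stabiliser of the first `i`
entries does not fix the `(i+1)`-st entry. -/
def IsIrredundantTuple (G : Type*) {Ω : Type*} [Group G] [MulAction G Ω] (l : List Ω) : Prop :=
  ∀ i : Fin l.length, ∃ g ∈ listStabilizer G (l.take i), g • l.get i ≠ l.get i

/-- The base size of `G` on `Ω`: the minimal length of a base. -/
noncomputable def baseSize (G Ω : Type*) [Group G] [MulAction G Ω] : ℕ :=
  sInf {n | ∃ l : List Ω, l.length = n ∧ IsBaseTuple G l}

/-- `G` is an IBIS group on `Ω` if all irredundant bases have the same length. -/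
def IsIBIS (G Ω : Type*) [Group G] [MulAction G Ω] : Prop :=
  ∀ l₁ l₂ : List Ω, IsBaseTuple G l₁ → IsIrredundantTuple G l₁ →
    IsBaseTuple G l₂ → IsIrredundantTuple G l₂ → l₁.length = l₂.length

section IrredundantTuples

variable {G Ω : Type*} [Group G] [MulAction G Ω]

theorem mem_listStabilizer {l : List Ω} {g : G} :
    g ∈ listStabilizer G l ↔ ∀ ω ∈ l, g • ω = ω := by
  simp [listStabilizer, Subgroup.mem_iInf, MulAction.mem_stabilizer_iff]

theorem isBaseTuple_iff {l : List Ω} :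
    IsBaseTuple G l ↔ ∀ g : G, (∀ ω ∈ l, g • ω = ω) → g = 1 := by
  simp only [IsBaseTuple, Subgroup.eq_bot_iff_forall, mem_listStabilizer]

theorem IsBaseTuple.mono {l m : List Ω} (hl : IsBaseTuple G l) (h : l ⊆ m) : IsBaseTuple G m :=
  isBaseTuple_iff.2 fun g hg => isBaseTuple_iff.1 hl g fun ω hω => hg ω (h hω)

theorem isIrredundantTuple_nil : IsIrredundantTuple G ([] : List Ω) :=
  fun i => i.elim0

theorem isIrredundantTuple_append_singleton {l : List Ω} {a : Ω} :
    IsIrredundantTuple G (l ++ [a]) ↔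
      IsIrredundantTuple G l ∧ ∃ g ∈ listStabilizer G l, g • a ≠ a := by
  simp only [IsIrredundantTuple, Fin.forall_iff, List.get_eq_getElem]
  constructor
  · intro h
    refine ⟨fun i hi => ?_, ?_⟩
    · have := h i (by simp; omega)
      rwa [List.take_append_of_le_length hi.le, List.getElem_append_left hi] at this
    · simpa using h l.length (by simp)
  · rintro ⟨h, ha⟩ i hi
    rcases Nat.lt_or_ge i l.length with hil | hil
    · rw [List.take_append_of_le_length hil.le, List.getElem_append_left hil]
      exact h i hil
    · obtain rfl : i = l.length := by simp at hi; omega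
      simpa using ha

theorem IsIrredundantTuple.nodup {l : List Ω} (h : IsIrredundantTuple G l) : l.Nodup := by
  induction l using List.reverseRecOn with
  | nil => exact List.nodup_nil
  | append_singleton l a ih =>
    obtain ⟨hl, g, hg, hga⟩ := isIrredundantTuple_append_singleton.1 h
    rw [← List.concat_eq_append]
    exact (ih hl).concat fun hal => hga (mem_listStabilizer.1 hg a hal)

/-- An irredundant tuple extends by points of `m` to an irredundant tuple whose stabiliser fixes
every point of `m`. -/
theorem IsIrredundantTuple.exists_extension (m : List Ω) {l : List Ω}
    (hl : IsIrredundantTuple G l) :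
    ∃ m', m'.Sublist m ∧ IsIrredundantTuple G (l ++ m') ∧
      listStabilizer G (l ++ m') ≤ listStabilizer G m := by
  induction m generalizing l with
  | nil =>
    exact ⟨[], List.Sublist.refl _, by simpa using hl, fun g _ => mem_listStabilizer.2 (by simp)⟩
  | cons a m ih =>
    by_cases ha : ∃ g ∈ listStabilizer G l, g • a ≠ a
    · obtain ⟨m', hm', hirr, hle⟩ := ih (isIrredundantTuple_append_singleton.2 ⟨hl, ha⟩)
      rw [List.append_assoc, List.singleton_append] at hirr hle
      refine ⟨a :: m', hm'.cons_cons a, hirr, fun g hg => mem_listStabilizer.2 ?_⟩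
      exact List.forall_mem_cons.2
        ⟨mem_listStabilizer.1 hg a (by simp), mem_listStabilizer.1 (hle hg)⟩
    · push Not at ha
      obtain ⟨m', hm', hirr, hle⟩ := ih hl
      refine ⟨m', hm'.cons a, hirr, fun g hg => mem_listStabilizer.2 ?_⟩
      refine List.forall_mem_cons.2 ⟨ha g (mem_listStabilizer.2 fun ω hω => ?_),
        mem_listStabilizer.1 (hle hg)⟩
      exact mem_listStabilizer.1 hg ω (List.mem_append_left _ hω)

theorem IsIrredundantTuple.exists_extension_isBaseTuple {l m : List Ω}
    (hl : IsIrredundantTuple G l) (hm : IsBaseTuple G m) :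
    ∃ m', m'.Sublist m ∧ IsIrredundantTuple G (l ++ m') ∧ IsBaseTuple G (l ++ m') := by
  obtain ⟨m', hsub, hirr, hle⟩ := hl.exists_extension m
  exact ⟨m', hsub, hirr, le_bot_iff.1 (hle.trans_eq hm)⟩

variable (G Ω) in
theorem exists_isBaseTuple [Finite G] [FaithfulSMul G Ω] : ∃ l : List Ω, IsBaseTuple G l := by
  cases nonempty_fintype G
  have moved (g : {g : G // g ≠ 1}) : ∃ ω : Ω, g.1 • ω ≠ ω := by
    by_contra! h
    exact g.2 (FaithfulSMul.eq_of_smul_eq_smul fun ω : Ω => by rw [h, one_smul])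
  choose f hf using moved
  classical
  refine ⟨Finset.univ.toList.map f, isBaseTuple_iff.2 fun g hg => ?_⟩
  by_contra hne
  exact hf ⟨g, hne⟩ (hg _ (List.mem_map_of_mem (by simp)))

/-- In an IBIS group, every reordering of an irredundant base is irredundant. -/
theorem IsIBIS.isIrredundantTuple_of_perm (h : IsIBIS G Ω) {l l' : List Ω}
    (hb : IsBaseTuple G l) (hi : IsIrredundantTuple G l) (hp : l.Perm l') :
    IsIrredundantTuple G l' := by
  obtain ⟨m, hsub, hmi, hmb⟩ :=
    isIrredundantTuple_nil.exists_extension_isBaseTuple (hb.mono hp.subset)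
  rw [List.nil_append] at hmi hmb
  rwa [← hsub.eq_of_length ((h m l hmb hmi hb hi).trans hp.length_eq)]

theorem IsIBIS.exchangeProperty (h : IsIBIS G Ω) :
    Matroid.ExchangeProperty fun s : Set Ω =>
      ∃ l : List Ω, IsBaseTuple G l ∧ IsIrredundantTuple G l ∧ {ω | ω ∈ l} = s := by
  rintro _ _ ⟨l₁, hb₁, hi₁, rfl⟩ ⟨l₂, hb₂, hi₂, rfl⟩ e ⟨he₁, he₂⟩
  obtain ⟨s, t, rfl⟩ := List.append_of_mem he₁
  have hp : (s ++ e :: t).Perm (s ++ t ++ [e]) := by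
    rw [List.append_assoc]
    exact (List.perm_append_singleton e t).symm.append_left s
  have hi := h.isIrredundantTuple_of_perm hb₁ hi₁ hp
  obtain ⟨m, hsub, hmi, hmb⟩ :=
    (isIrredundantTuple_append_singleton.1 hi).1.exists_extension_isBaseTuple hb₂
  have hlen := h _ _ hmb hmi (hb₁.mono hp.subset) hi
  obtain ⟨f, rfl⟩ : ∃ f, m = [f] := by
    rw [← List.length_eq_one_iff]
    simpa only [List.length_append, List.length_singleton, Nat.add_left_cancel_iff] using hlen
  have hf₂ : f ∈ l₂ := hsub.subset (List.mem_singleton_self f)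
  have hfe : f ≠ e := fun hfe => he₂ (hfe ▸ hf₂)
  have hnf := hmi.nodup
  have hne := hi.nodup
  refine ⟨f, ⟨hf₂, ?_⟩, s ++ t ++ [f], hmb, hmi, ?_⟩
  · simp only [List.nodup_append, Set.mem_ofPred_eq, List.mem_append, List.mem_cons] at hnf ⊢
    grind
  · ext ω
    simp only [List.nodup_append, Set.mem_ofPred_eq, List.mem_append, List.mem_cons,
      Set.mem_insert_iff, Set.mem_sdiff, Set.mem_singleton_iff, List.not_mem_nil] at hne ⊢
    grind

theorem IsIrredundantTuple.ncard_setOf_mem {l : List Ω} (h : IsIrredundantTuple G l) :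
    {ω | ω ∈ l}.ncard = l.length := by
  classical
  rw [← List.toFinset_card_of_nodup h.nodup, ← Set.ncard_coe_finset, List.coe_toFinset]

end IrredundantTuples

/-- Cameron–Fon-Der-Flaass: `G` is IBIS iff the (sets of points of) irredundant bases of `G`
form the bases of a matroid on ground set `Ω`. -/
theorem isIBIS_iff_matroid {G Ω : Type*} [Group G] [Finite G] [MulAction G Ω]
    [FaithfulSMul G Ω] :
    IsIBIS G Ω ↔ ∃ M : Matroid Ω, M.E = Set.univ ∧
      ∀ s : Set Ω, M.IsBase s ↔
        ∃ l : List Ω, IsBaseTuple G l ∧ IsIrredundantTuple G l ∧ {ω | ω ∈ l} = s := by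
  constructor
  · intro h
    obtain ⟨b, hb⟩ := exists_isBaseTuple G Ω
    obtain ⟨l, -, hli, hlb⟩ := isIrredundantTuple_nil.exists_extension_isBaseTuple hb
    refine ⟨Matroid.ofExistsFiniteIsBase Set.univ _
      ⟨_, ⟨[] ++ l, hlb, hli, rfl⟩, List.finite_toSet _⟩ h.exchangeProperty
      fun _ _ => Set.subset_univ _, rfl, fun s => Iff.rfl⟩
  · rintro ⟨M, -, hM⟩ l₁ l₂ hb₁ hi₁ hb₂ hi₂
    rw [← hi₁.ncard_setOf_mem, ← hi₂.ncard_setOf_mem]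
    exact ((hM _).2 ⟨l₁, hb₁, hi₁, rfl⟩).ncard_eq_ncard_of_isBase ((hM _).2 ⟨l₂, hb₂, hi₂, rfl⟩)
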